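/- arXiv:1311.0599 — 2 statements merged into one kernel-verified Lean document; each statement's English description precedes it below -/
import Mathlib

section
/- For any positive integers n, s and any odd positive integer m, the number of conjugacy classes of the full orthogonal group O(2n) consisting of elements x with x^m = 1 and with exactly s distinct conjugate pairs of eigenvalues equals C(n-1, s-1) · C(⌊m/2⌋ + 1, s). -/
open Matrix

open Polynomial in
/-- A complex matrix of finite order is diagonalizable. -/
theorem Matrix.exists_unit_mul_diagonal_of_pow_eq_one {ι : Type*} [Fintype ι] [DecidableEq ι]
    {A : Matrix ι ι ℂ} {m : ℕ} (hm : m ≠ 0) (hA : A ^ m = 1) :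
    ∃ (P : (Matrix ι ι ℂ)ˣ) (d : ι → ℂ), A * P.val = P.val * diagonal d := by
  let f : Module.End ℂ (ι → ℂ) := toLin' A
  have hf : f.IsSemisimple := by
    refine Module.End.isSemisimple_of_squarefree_aeval_eq_zero (p := X ^ m - 1)
      (X_pow_sub_one_separable_iff.2 (by exact_mod_cast hm)).squarefree ?_
    have : f ^ m = 1 := by
      simp only [f]
      rw [← toLin'_pow, hA, toLin'_one]; rfl
    simp [this]
  have D := DirectSum.isInternal_submodule_of_iSupIndep_of_iSup_eq_top
    f.eigenspaces_iSupIndep hf.iSup_eigenspace_eq_top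
  obtain ⟨b, d, hb⟩ : ∃ (b : Module.Basis ι ℂ (ι → ℂ)) (d : ι → ℂ), ∀ i, f (b i) = d i • b i := by
    let v := D.collectedBasis fun μ ↦ Module.finBasis ℂ (f.eigenspace μ)
    let e := v.indexEquiv (Pi.basisFun ℂ ι)
    refine ⟨v.reindex e, fun i ↦ (e.symm i).1, fun i ↦ ?_⟩
    rw [Module.Basis.reindex_apply]
    exact Module.End.mem_eigenspace_iff.mp (D.collectedBasis_mem _ _)
  let _ := (Pi.basisFun ℂ ι).invertibleToMatrix b
  refine ⟨unitOfInvertible ((Pi.basisFun ℂ ι).toMatrix b), d, ?_⟩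
  ext i j
  have := congrFun (hb j) i
  rw [mul_diagonal]
  simpa [f, mul_apply, mulVec, dotProduct, Module.Basis.toMatrix_apply, mul_comm] using this

/-- Two tuples with the same multiset of values differ by a permutation. -/
theorem Multiset.exists_perm_of_map_univ_eq {ι α : Type*} [Fintype ι] {d c : ι → α}
    (h : Finset.univ.val.map d = Finset.univ.val.map c) : ∃ σ : Equiv.Perm ι, ∀ i, c (σ i) = d i := by
  classical
  have e (z : α) : Nonempty ({i // d i = z} ≃ {i // c i = z}) := by
    rw [← Fintype.card_eq, Fintype.card_subtype, Fintype.card_subtype]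
    have := congrArg (Multiset.count z) h
    rw [Multiset.count_map, Multiset.count_map] at this
    simpa [Finset.card, Finset.filter, eq_comm] using this
  exact ⟨Equiv.ofFiberEquiv fun z ↦ (e z).some, Equiv.ofFiberEquiv_map _⟩

/-- Complex matrices of finite order with the same characteristic polynomial are similar. -/
theorem Matrix.exists_unit_of_pow_eq_one_of_charpoly_eq {ι : Type*} [Fintype ι] [DecidableEq ι]
    {A B : Matrix ι ι ℂ} {m : ℕ} (hm : m ≠ 0) (hA : A ^ m = 1) (hB : B ^ m = 1)
    (h : A.charpoly = B.charpoly) :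
    ∃ R : (Matrix ι ι ℂ)ˣ, B * R.val = R.val * A := by
  obtain ⟨P, d, hP⟩ := exists_unit_mul_diagonal_of_pow_eq_one hm hA
  obtain ⟨Q, c, hQ⟩ := exists_unit_mul_diagonal_of_pow_eq_one hm hB
  have key {A : Matrix ι ι ℂ} {P : (Matrix ι ι ℂ)ˣ} {d : ι → ℂ}
      (hP : A * P.val = P.val * diagonal d) :
      A.charpoly.roots = Finset.univ.val.map d := by
    have : A = P.val * diagonal d * P.val⁻¹ := by
      rw [← hP, ← coe_units_inv, mul_assoc, Units.mul_inv, mul_one]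
    rw [this, charpoly_units_conj, charpoly_diagonal]
    have := Polynomial.roots_multiset_prod_X_sub_C (Finset.univ.val.map d)
    rwa [Multiset.map_map] at this
  have hdc : Finset.univ.val.map d = Finset.univ.val.map c := by rw [← key hP, ← key hQ, h]
  obtain ⟨σ, hσ⟩ := Multiset.exists_perm_of_map_univ_eq hdc
  let W : (Matrix ι ι ℂ)ˣ := ⟨σ.symm.toPEquiv.toMatrix, σ.toPEquiv.toMatrix,
    by rw [← PEquiv.toMatrix_trans, ← Equiv.toPEquiv_trans]; simp,
    by rw [← PEquiv.toMatrix_trans, ← Equiv.toPEquiv_trans]; simp⟩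
  have hW : diagonal c * W.val = W.val * diagonal d := by
    ext i j
    simp only [W, diagonal_mul, mul_diagonal, PEquiv.toMatrix_apply, Equiv.toPEquiv_apply,
      Option.mem_def, Option.some.injEq]
    split_ifs with hij
    · rw [← hij, ← hσ]; simp
    · simp
  refine ⟨Q * W * P⁻¹, ?_⟩
  rw [Units.val_mul, Units.val_mul, ← mul_assoc, ← mul_assoc, hQ, mul_assoc Q.val, hW,
    mul_assoc _ _ A, show P⁻¹.val * A = diagonal d * P⁻¹.val by
      rw [Units.inv_mul_eq_iff_eq_mul, ← mul_assoc, ← hP, mul_assoc, Units.mul_inv, mul_one]]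
  simp only [mul_assoc]

/-- Real matrices that are similar over `ℂ` are similar over `ℝ`. -/
theorem Matrix.exists_real_unit_of_complex_unit {ι : Type*} [Fintype ι] [DecidableEq ι]
    {A B : Matrix ι ι ℝ} {R : (Matrix ι ι ℂ)ˣ}
    (h : B.map Complex.ofReal * R.val = R.val * A.map Complex.ofReal) :
    ∃ S : (Matrix ι ι ℝ)ˣ, B * S.val = S.val * A := by
  let U : Matrix ι ι ℝ := R.val.map Complex.re
  let V : Matrix ι ι ℝ := R.val.map Complex.im
  have hU : B * U = U * A := by
    ext i j
    have := congrArg Complex.re (congrFun (congrFun h i) j)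
    simpa [mul_apply, U] using this
  have hV : B * V = V * A := by
    ext i j
    have := congrArg Complex.im (congrFun (congrFun h i) j)
    simpa [mul_apply, V] using this
  let p : Polynomial ℝ := (U.map Polynomial.C + (Polynomial.X : Polynomial ℝ) • V.map Polynomial.C).det
  have hp : p ≠ 0 := by
    intro h0
    have h1 : p.eval₂ Complex.ofRealHom Complex.I = R.val.det := by
      rw [← Polynomial.coe_eval₂RingHom, RingHom.map_det]
      congr 1
      ext i j
      simp [U, V]
    rw [h0] at h1
    have := (isUnit_iff_isUnit_det _).1 R.isUnit
    simp [← h1] at this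
  obtain ⟨t, ht⟩ : ∃ t : ℝ, p.eval t ≠ 0 := by
    by_contra! hc
    exact hp (Polynomial.funext fun t ↦ by simp [hc])
  have ht' : IsUnit (U + t • V) := by
    rw [isUnit_iff_isUnit_det, isUnit_iff_ne_zero]
    convert ht
    rw [← Polynomial.coe_evalRingHom, RingHom.map_det]
    congr 1
    ext i j
    simp [mul_comm t]
  refine ⟨ht'.unit, ?_⟩
  simp [mul_add, add_mul, hU, hV]

open scoped MatrixOrder in
/-- Orthogonal real matrices that are similar are similar via an orthogonal matrix. -/
theorem Matrix.isConj_orthogonalGroup_of_similar {ι : Type*} [Fintype ι] [DecidableEq ι]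
    {x y : orthogonalGroup ι ℝ} {P : (Matrix ι ι ℝ)ˣ} (h : y.val * P.val = P.val * x.val) :
    IsConj x y := by
  have hx : star x.val * x.val = 1 := Unitary.star_mul_self_of_mem x.2
  have hx' : x.val * star x.val = 1 := Unitary.mul_star_self_of_mem x.2
  have hy : star y.val * y.val = 1 := Unitary.star_mul_self_of_mem y.2
  set p := P.val
  have hpos : 0 ≤ star p * p := star_mul_self_nonneg p
  set S := CFC.sqrt (star p * p)
  have hS : S * S = star p * p := CFC.sqrt_mul_sqrt_self _ hpos
  have hSu : IsUnit S := by
    rw [CFC.isUnit_sqrt_iff _ hpos]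
    exact (P.isUnit.star).mul P.isUnit
  have hSs : star S = S := (IsSelfAdjoint.of_nonneg (CFC.sqrt_nonneg _)).star_eq
  have hcomm : Commute (star p * p) x.val := by
    have h1 : star p * star y.val = star x.val * star p := by
      rw [← star_mul, h, star_mul]
    calc star p * p * x.val = star p * (y.val * p) := by rw [h, mul_assoc]
      _ = x.val * star x.val * star p * (y.val * p) := by rw [hx', one_mul]
      _ = x.val * (star p * (star y.val * y.val) * p) := by
        rw [mul_assoc x.val, ← h1]; simp only [mul_assoc]
      _ = x.val * (star p * p) := by rw [hy, mul_one]
  have hSx : Commute S x.val := hcomm.cfcₙ_nnreal _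
  obtain ⟨s, hs⟩ := hSu
  have hsx : Commute s⁻¹.val x.val := by
    rw [← hs] at hSx; exact hSx.units_inv_left
  have hss : star s⁻¹.val = s⁻¹.val := by
    rw [← hs] at hSs
    have : star s = s := Units.ext hSs
    rw [← Units.coe_star, star_inv, this]
  have hO : p * s⁻¹.val ∈ orthogonalGroup ι ℝ := by
    rw [mem_orthogonalGroup_iff', ← conjTranspose_eq_transpose_of_trivial, ← star_eq_conjTranspose, star_mul, hss, ← mul_assoc, mul_assoc s⁻¹.val, ← hS, ← hs]
    simp
  rw [isConj_iff]
  refine ⟨⟨_, hO⟩, mul_inv_eq_iff_eq_mul.2 (Subtype.ext ?_)⟩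
  simp only [Submonoid.coe_mul]
  rw [← mul_assoc, h, mul_assoc, hsx.eq, mul_assoc]

/-- The number of multisets of given size and given number of distinct elements. -/
theorem Multiset.ncard_card_eq_and_card_toFinset_eq {α : Type*} [Fintype α] [DecidableEq α]
    {n s : ℕ} (hn : 0 < n) (hs : 0 < s) :
    {M : Multiset α | M.card = n ∧ M.toFinset.card = s}.ncard
      = (n - 1).choose (s - 1) * (Fintype.card α).choose s := by
  rcases lt_or_ge n s with hns | hns
  · rw [Nat.choose_eq_zero_of_lt (by lia), zero_mul]
    convert Set.ncard_empty (Multiset α)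
    refine Set.eq_empty_of_forall_notMem fun M hM ↦ ?_
    have := M.toFinset_card_le
    have := hM.1
    have := hM.2
    lia
  let g (S : Finset α) (f : α →₀ ℕ) : Multiset α := f.toMultiset + S.val
  have hg (S : Finset α) : Function.Injective (g S) := fun f f' h ↦
    Multiset.toFinsupp.symm.injective (add_right_cancel h)
  have hgS {S : Finset α} {f : α →₀ ℕ} (hf : f ∈ S.finsuppAntidiag (n - s)) :
      (g S f).toFinset = S := by
    have := (Finset.mem_finsuppAntidiag.1 hf).2
    simpa [g, Multiset.toFinset_add] using this
  have hcard {S : Finset α} {f : α →₀ ℕ} (hf : f.support ⊆ S) :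
      f.toMultiset.card = ∑ i ∈ S, f i := by
    rw [Finsupp.card_toMultiset, Finsupp.sum_of_support_subset _ hf _ (by simp)]
    rfl
  have hset : {M : Multiset α | M.card = n ∧ M.toFinset.card = s} =
      ↑((Finset.univ.powersetCard s).biUnion fun S ↦ (S.finsuppAntidiag (n - s)).image (g S)) := by
    ext M
    simp only [Set.mem_ofPred_eq, Finset.coe_biUnion, Finset.mem_coe, Finset.mem_powersetCard,
      Finset.subset_univ, true_and, Set.mem_iUnion, Finset.coe_image, Set.mem_image, exists_prop]
    constructor
    · rintro ⟨hM, hS⟩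
      have hle : M.toFinset.val ≤ M := by simpa using M.dedup_le
      refine ⟨M.toFinset, hS, (M - M.toFinset.val).toFinsupp, ?_, ?_⟩
      · have hsub : (M - M.toFinset.val).toFinsupp.support ⊆ M.toFinset := by
          rw [Multiset.toFinsupp_support]
          exact Multiset.toFinset_subset.2 (Multiset.subset_of_le (Multiset.sub_le_self _ _))
        rw [Finset.mem_finsuppAntidiag, ← hcard hsub, Multiset.toFinsupp_toMultiset,
          Multiset.card_sub hle, hM]
        exact ⟨congrArg _ hS, hsub⟩
      · simp only [g, Multiset.toFinsupp_toMultiset]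
        exact Multiset.sub_add_cancel hle
    · rintro ⟨S, hS, f, hf, rfl⟩
      refine ⟨?_, by rw [hgS hf, hS]⟩
      have := Finset.mem_finsuppAntidiag.1 hf
      have hc : S.val.card = s := hS
      rw [Multiset.card_add, hcard this.2, hc, this.1, Nat.sub_add_cancel hns]
  rw [hset, Set.ncard_coe_finset, Finset.card_biUnion]
  · rw [Finset.sum_congr rfl (g := fun _ ↦ (n - 1).choose (s - 1))]
    · simp [mul_comm]
    · intro S hS
      rw [Finset.card_image_of_injective _ (hg S), Finset.card_finsuppAntidiag_nat_eq_choose,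
        (Finset.mem_powersetCard.1 hS).2, ← Nat.choose_symm (by lia)]
      congr 1 <;> lia
  · intro S _ S' _ hne
    simp only [Function.onFun, Finset.disjoint_left, Finset.mem_image]
    rintro _ ⟨f, hf, rfl⟩ ⟨f', hf', h⟩
    exact hne (by rw [← hgS hf, ← h, hgS hf'])

theorem Multiset.exists_map_univ_eq {α : Type*} {n : ℕ} {M : Multiset α} (h : M.card = n) :
    ∃ f : Fin n → α, Finset.univ.val.map f = M := by
  subst h
  induction M using Quotient.inductionOn with
  | _ l => exact ⟨l.get, (Fin.univ_val_map _).trans (congrArg _ (List.ofFn_get l))⟩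

open ComplexConjugate

/-- A multiset of complex numbers in the closed upper half plane is determined by the multiset
obtained by adding all conjugates. -/
theorem Multiset.eq_of_add_map_conj_eq {M N : Multiset ℂ} (hM : ∀ z ∈ M, 0 ≤ z.im)
    (hN : ∀ z ∈ N, 0 ≤ z.im) (h : M + M.map conj = N + N.map conj) : M = N := by
  ext z
  have h1 := congrArg (Multiset.count z) h
  have hc (M : Multiset ℂ) : (M.map conj).count z = M.count (conj z) := by
    conv_lhs => rw [← Complex.conj_conj z]
    exact Multiset.count_map_eq_count' _ _ (starRingEnd ℂ).injective _
  rw [count_add, count_add, hc, hc] at h1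
  rcases lt_trichotomy z.im 0 with hz | hz | hz
  · rw [count_eq_zero_of_notMem fun hz' ↦ (hM z hz').not_gt hz,
      count_eq_zero_of_notMem fun hz' ↦ (hN z hz').not_gt hz]
  · rw [Complex.conj_eq_iff_im.2 hz] at h1
    lia
  · have hz' : (conj z).im < 0 := by simpa
    rwa [count_eq_zero_of_notMem fun h ↦ (hM _ h).not_gt hz',
      count_eq_zero_of_notMem fun h ↦ (hN _ h).not_gt hz'] at h1

/-- A conjugation-invariant multiset of complex numbers of even size whose only real element is `1`
consists of conjugate pairs. -/
theorem Multiset.exists_add_map_conj_eq {T : Multiset ℂ} {n : ℕ} (hT : T.map conj = T)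
    (hcard : T.card = 2 * n) (hone : ∀ z ∈ T, z.im = 0 → z = 1) :
    ∃ M : Multiset ℂ, (∀ z ∈ M, z ∈ T ∧ 0 ≤ z.im) ∧ T = M + M.map conj := by
  have hneg : T.filter (fun z ↦ z.im < 0) = (T.filter (fun z ↦ 0 < z.im)).map conj := by
    conv_lhs => rw [← hT, filter_map]
    simp
  have hreal : T.filter (fun z ↦ z.im = 0) = replicate (T.filter (fun z ↦ z.im = 0)).card 1 := by
    rw [eq_replicate_card]
    intro z hz
    rw [mem_filter] at hz
    exact hone z hz.1 hz.2
  have hsplit : T = T.filter (fun z ↦ 0 < z.im) + (T.filter (fun z ↦ z.im < 0) +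
      T.filter (fun z ↦ z.im = 0)) := by
    ext z
    simp only [count_add, count_filter]
    rcases lt_trichotomy z.im 0 with hz | hz | hz
    · simp [hz, hz.ne, hz.le]
    · simp [hz]
    · simp [hz, hz.ne', hz.le]
  have hc := congrArg card hsplit
  rw [card_add, card_add, hneg, card_map, hcard] at hc
  obtain ⟨k, hk⟩ : ∃ k, (T.filter (fun z ↦ z.im = 0)).card = k + k :=
    ⟨n - (T.filter (fun z ↦ 0 < z.im)).card, by lia⟩
  refine ⟨T.filter (fun z ↦ 0 < z.im) + replicate k 1, fun z hz ↦ ?_, ?_⟩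
  · rw [mem_add, mem_filter, mem_replicate] at hz
    rcases hz with hz | ⟨hk0, rfl⟩
    · exact ⟨hz.1, hz.2.le⟩
    · refine ⟨?_, by simp⟩
      have : (1 : ℂ) ∈ T.filter (fun z ↦ z.im = 0) := by
        rw [hreal, mem_replicate]; exact ⟨by lia, rfl⟩
      exact (mem_filter.1 this).1
  · conv_lhs => rw [hsplit, hneg, hreal, hk, replicate_add]
    simp only [Multiset.map_add, map_replicate, map_one]
    abel

/-- The complex eigenvalues of a real matrix, with multiplicity. -/
noncomputable def Matrix.complexEigenvalues {ι : Type*} [Fintype ι] [DecidableEq ι]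
    (A : Matrix ι ι ℝ) : Multiset ℂ :=
  (A.charpoly.map Complex.ofRealHom).roots

section
variable {ι : Type*} [Fintype ι] [DecidableEq ι]

theorem Matrix.charpoly_map_ofReal (A : Matrix ι ι ℝ) :
    (A.map Complex.ofReal).charpoly = A.charpoly.map Complex.ofRealHom :=
  charpoly_map A Complex.ofRealHom

theorem Matrix.mem_complexEigenvalues {A : Matrix ι ι ℝ} {z : ℂ} :
    z ∈ A.complexEigenvalues ↔ z ∈ spectrum ℂ (A.map Complex.ofReal) := by
  rw [mem_spectrum_iff_isRoot_charpoly, complexEigenvalues, Polynomial.mem_roots,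
    charpoly_map_ofReal]
  exact ((charpoly_monic A).map _).ne_zero

theorem Matrix.card_complexEigenvalues (A : Matrix ι ι ℝ) :
    A.complexEigenvalues.card = Fintype.card ι := by
  rw [complexEigenvalues, IsAlgClosed.card_roots_eq_natDegree, Polynomial.natDegree_map,
    charpoly_natDegree_eq_dim]

theorem Matrix.map_conj_complexEigenvalues (A : Matrix ι ι ℝ) :
    A.complexEigenvalues.map conj = A.complexEigenvalues := by
  rw [complexEigenvalues, ← (IsAlgClosed.splits _).roots_map, Polynomial.map_map]
  congr 2
  ext; simp

theorem Matrix.pow_eq_one_of_mem_complexEigenvalues {A : Matrix ι ι ℝ} {m : ℕ} (hA : A ^ m = 1)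
    {z : ℂ} (hz : z ∈ A.complexEigenvalues) : z ^ m = 1 := by
  have h := spectrum.pow_mem_pow _ m (mem_complexEigenvalues.1 hz)
  have hA' : A.map Complex.ofReal ^ m = 1 := by
    have := congrArg (Complex.ofRealHom.mapMatrix) hA
    rwa [map_pow, map_one] at this
  rw [hA', spectrum.mem_iff] at h
  by_contra hne
  apply h
  rw [← map_one (algebraMap ℂ (Matrix ι ι ℂ)), ← map_sub]
  exact (IsUnit.mk0 _ (sub_ne_zero.2 hne)).map _

theorem Matrix.complexEigenvalues_eq_of_isConj {x y : orthogonalGroup ι ℝ} (h : IsConj x y) :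
    x.val.complexEigenvalues = y.val.complexEigenvalues := by
  obtain ⟨c, rfl⟩ := isConj_iff.1 h
  have : (c * x * c⁻¹).val = c.val * (x * c⁻¹).val := by rw [mul_assoc]; rfl
  rw [complexEigenvalues, complexEigenvalues, this, charpoly_mul_comm]
  congr 3
  rw [← Submonoid.coe_mul]
  simp

end

/-- The block diagonal matrix with rotations by the angles `θ i` as blocks. -/
noncomputable def Matrix.blockRotation {n : ℕ} (θ : Fin n → ℝ) :
    Matrix (Fin (2 * n)) (Fin (2 * n)) ℝ :=
  reindexAlgEquiv ℝ ℝ finProdFinEquiv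
    (blockDiagonal fun i ↦ !![Real.cos (θ i), -Real.sin (θ i); Real.sin (θ i), Real.cos (θ i)])

theorem Matrix.blockRotation_mul {n : ℕ} (θ φ : Fin n → ℝ) :
    blockRotation θ * blockRotation φ = blockRotation (θ + φ) := by
  rw [blockRotation, blockRotation, ← map_mul, ← blockDiagonal_mul, blockRotation]
  congr! 3 with i
  simp only [mul_fin_two, Pi.add_apply, Real.cos_add, Real.sin_add]
  ext i j
  fin_cases i <;> fin_cases j <;> simp <;> ring

theorem Matrix.blockRotation_eq_one {n : ℕ} {θ : Fin n → ℝ} (h : ∀ i, Real.cos (θ i) = 1)  :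
    blockRotation θ = 1 := by
  have h' (i) : Real.sin (θ i) = 0 := Real.sin_eq_zero_iff_cos_eq.2 (.inl (h i))
  simp only [blockRotation, h, h', neg_zero, ← one_fin_two]
  exact (congrArg _ blockDiagonal_one).trans (map_one _)

theorem Matrix.blockRotation_pow {n : ℕ} (θ : Fin n → ℝ) (m : ℕ) :
    blockRotation θ ^ m = blockRotation (m • θ) := by
  induction m with
  | zero => rw [pow_zero, blockRotation_eq_one]; simp
  | succ m ih => rw [pow_succ, ih, blockRotation_mul, succ_nsmul]

theorem Matrix.blockRotation_mem_orthogonalGroup {n : ℕ} (θ : Fin n → ℝ) :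
    blockRotation θ ∈ orthogonalGroup (Fin (2 * n)) ℝ := by
  have : (blockRotation θ)ᵀ = blockRotation (-θ) := by
    simp only [blockRotation, coe_reindexAlgEquiv, transpose_reindex, blockDiagonal_transpose]
    congr! 3 with i
    ext i j
    fin_cases i <;> fin_cases j <;> simp
  rw [mem_orthogonalGroup_iff, this, blockRotation_mul, blockRotation_eq_one]
  simp

open Polynomial in
theorem Matrix.charpoly_blockDiagonal {ι κ R : Type*} [Fintype ι] [DecidableEq ι] [Fintype κ]
    [DecidableEq κ] [CommRing R] (M : κ → Matrix ι ι R) :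
    (blockDiagonal M).charpoly = ∏ i, (M i).charpoly := by
  rw [charpoly, show (blockDiagonal M).charmatrix = blockDiagonal fun i ↦ (M i).charmatrix from ?_,
    det_blockDiagonal]
  · rfl
  · ext ⟨i, k⟩ ⟨j, l⟩
    simp only [charmatrix_apply, blockDiagonal_apply, diagonal_apply, Prod.mk.injEq]
    split_ifs <;> simp_all

open Polynomial in
theorem Matrix.complexEigenvalues_blockRotation {n : ℕ} (θ : Fin n → ℝ) :
    (blockRotation θ).complexEigenvalues =
      (Finset.univ.val.map fun i ↦ Complex.exp (θ i * Complex.I)) +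
        (Finset.univ.val.map fun i ↦ Complex.exp (θ i * Complex.I)).map conj := by
  have key : (blockRotation θ).charpoly.map Complex.ofRealHom =
      (((Finset.univ.val.map fun i ↦ Complex.exp (θ i * Complex.I)) +
        (Finset.univ.val.map fun i ↦ Complex.exp (θ i * Complex.I)).map conj).map
          fun z ↦ X - C z).prod := by
    rw [blockRotation, coe_reindexAlgEquiv, charpoly_reindex, charpoly_blockDiagonal,
      Polynomial.map_prod]
    simp only [Multiset.map_add, Multiset.map_map, Multiset.prod_add]
    change _ = (∏ i, _) * (∏ i, _)
    rw [← Finset.prod_mul_distrib]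
    refine Finset.prod_congr rfl fun i _ ↦ ?_
    have h : (X - C (Complex.exp (θ i * Complex.I))) * (X - C (conj (Complex.exp (θ i * Complex.I))))
        = X ^ 2 - C (2 * Real.cos (θ i) : ℂ) * X + 1 := by
      have h1 : Complex.exp (θ i * Complex.I) + conj (Complex.exp (θ i * Complex.I)) =
          2 * Real.cos (θ i) := by
        rw [Complex.add_conj, Complex.exp_ofReal_mul_I_re]; push_cast; rfl
      have h2 : Complex.exp (θ i * Complex.I) * conj (Complex.exp (θ i * Complex.I)) = 1 := by
        rw [Complex.mul_conj, Complex.normSq_eq_norm_sq, Complex.norm_exp_ofReal_mul_I]; simp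
      rw [← h1, ← C_1, ← h2, C_add, C_mul]
      ring
    simp only [Function.comp_apply]
    rw [h, charpoly_fin_two, trace_fin_two, det_fin_two]
    simp [← two_mul, ← sq, Real.cos_sq_add_sin_sq]
  rw [complexEigenvalues, key, Polynomial.roots_multiset_prod_X_sub_C]

/-- The `j`-th power of the standard primitive `m`-th root of unity, for `j ≤ m / 2`. -/
noncomputable def upperRootOfUnity (m : ℕ) (j : Fin (m / 2 + 1)) : ℂ :=
  Complex.exp (2 * Real.pi * Complex.I / m) ^ (j : ℕ)

theorem upperRootOfUnity_eq_exp (m : ℕ) (j : Fin (m / 2 + 1)) :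
    upperRootOfUnity m j = Complex.exp ((2 * Real.pi * j / m : ℝ) * Complex.I) := by
  rw [upperRootOfUnity, ← Complex.exp_nat_mul]
  congr 1
  push_cast
  ring

theorem upperRootOfUnity_injective {m : ℕ} (hm : 0 < m) :
    Function.Injective (upperRootOfUnity m) := fun i j h ↦
  Fin.ext <| (Complex.isPrimitiveRoot_exp m hm.ne').pow_inj
    (by have := i.2; have := Nat.div_mul_le_self m 2; lia)
    (by have := j.2; have := Nat.div_mul_le_self m 2; lia) h

theorem im_upperRootOfUnity_nonneg {m : ℕ} (j : Fin (m / 2 + 1)) :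
    0 ≤ (upperRootOfUnity m j).im := by
  rw [upperRootOfUnity_eq_exp, Complex.exp_ofReal_mul_I_im]
  refine Real.sin_nonneg_of_nonneg_of_le_pi (by positivity) ?_
  rcases Nat.eq_zero_or_pos m with rfl | hm
  · simp [Real.pi_nonneg]
  have hj : 2 * (j : ℝ) ≤ m := by
    have := j.2
    exact_mod_cast (by lia : 2 * (j : ℕ) ≤ m)
  rw [div_le_iff₀ (by exact_mod_cast hm)]
  nlinarith [Real.pi_pos]

theorem Complex.eq_one_of_pow_eq_one_of_im_eq_zero {m : ℕ} (hodd : Odd m) {z : ℂ}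
    (hz : z ^ m = 1) (him : z.im = 0) : z = 1 := by
  obtain ⟨x, rfl⟩ : ∃ x : ℝ, (x : ℂ) = z := ⟨z.re, Complex.ext rfl him.symm⟩
  have hx : x ^ m = 1 ^ m := by rw [one_pow]; exact_mod_cast hz
  rw [hodd.strictMono_pow.injective hx, ofReal_one]

theorem exists_upperRootOfUnity_eq {m : ℕ} (hodd : Odd m) {z : ℂ} (hz : z ^ m = 1)
    (him : 0 ≤ z.im) : ∃ j, upperRootOfUnity m j = z := by
  have hm := hodd.pos
  have : NeZero m := ⟨hm.ne'⟩
  obtain ⟨i, hi, rfl⟩ := (Complex.isPrimitiveRoot_exp m hm.ne').eq_pow_of_pow_eq_one hz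
  set w := Complex.exp (2 * Real.pi * Complex.I / m) with hw
  have hwm : w ^ m = 1 := (Complex.isPrimitiveRoot_exp m hm.ne').pow_eq_one
  by_cases hi2 : i < m / 2 + 1
  · exact ⟨⟨i, hi2⟩, rfl⟩
  · have hinv : w ^ (m - i) = conj (w ^ i) := by
      have hnorm : ‖w ^ i‖ = 1 := Complex.norm_eq_one_of_pow_eq_one hz hm.ne'
      rw [← Complex.inv_eq_conj hnorm, inv_eq_of_mul_eq_one_left]
      rw [← pow_add, Nat.sub_add_cancel hi.le, hwm]
    have h : 0 ≤ (w ^ (m - i)).im := im_upperRootOfUnity_nonneg ⟨m - i, by lia⟩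
    rw [hinv, Complex.conj_im] at h
    refine ⟨0, ?_⟩
    rw [Complex.eq_one_of_pow_eq_one_of_im_eq_zero hodd hz (by linarith)]
    simp [upperRootOfUnity]

/-- The orthogonal matrix whose complex eigenvalues are the `upperRootOfUnity m (f i)` and their
conjugates. -/
noncomputable def rootRotation (m : ℕ) {n : ℕ} (f : Fin n → Fin (m / 2 + 1)) :
    orthogonalGroup (Fin (2 * n)) ℝ :=
  ⟨_, blockRotation_mem_orthogonalGroup fun i ↦ 2 * Real.pi * f i / m⟩

theorem rootRotation_pow {m n : ℕ} (hm : 0 < m) (f : Fin n → Fin (m / 2 + 1)) :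
    rootRotation m f ^ m = 1 := by
  refine Subtype.ext ((blockRotation_pow _ m).trans (blockRotation_eq_one fun i ↦ ?_))
  rw [Pi.smul_apply, nsmul_eq_mul, mul_div_cancel₀ _ (by exact_mod_cast hm.ne'), mul_comm]
  exact Real.cos_nat_mul_two_pi _

theorem complexEigenvalues_rootRotation {m n : ℕ} (f : Fin n → Fin (m / 2 + 1)) :
    (rootRotation m f).val.complexEigenvalues =
      (Finset.univ.val.map f).map (upperRootOfUnity m) +
        ((Finset.univ.val.map f).map (upperRootOfUnity m)).map conj := by
  rw [rootRotation, complexEigenvalues_blockRotation]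
  simp only [← upperRootOfUnity_eq_exp, Multiset.map_map, Function.comp_def]

theorem isConj_of_complexEigenvalues_eq {ι : Type*} [Fintype ι] [DecidableEq ι] {m : ℕ}
    (hm : m ≠ 0) {x y : orthogonalGroup ι ℝ} (hx : x ^ m = 1) (hy : y ^ m = 1)
    (h : x.val.complexEigenvalues = y.val.complexEigenvalues) : IsConj x y := by
  have hpow {x : orthogonalGroup ι ℝ} (hx : x ^ m = 1) : x.val.map Complex.ofReal ^ m = 1 := by
    have := congrArg (Complex.ofRealHom.mapMatrix) (congrArg Subtype.val hx)
    rwa [SubmonoidClass.coe_pow, map_pow, OneMemClass.coe_one, map_one] at this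
  have hprod (A : Matrix ι ι ℝ) : (A.complexEigenvalues.map fun a ↦ .X - .C a).prod =
      (A.map Complex.ofReal).charpoly := by
    rw [charpoly_map_ofReal]
    exact ((IsAlgClosed.splits _).eq_prod_roots_of_monic ((charpoly_monic A).map _)).symm
  obtain ⟨R, hR⟩ := exists_unit_of_pow_eq_one_of_charpoly_eq hm (hpow hx) (hpow hy)
    (by rw [← hprod, ← hprod, h])
  obtain ⟨S, hS⟩ := exists_real_unit_of_complex_unit hR
  exact isConj_orthogonalGroup_of_similar hS

theorem isConj_rootRotation_iff {m n : ℕ} (hm : 0 < m) {f g : Fin n → Fin (m / 2 + 1)} :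
    IsConj (rootRotation m f) (rootRotation m g) ↔
      Finset.univ.val.map f = Finset.univ.val.map g := by
  constructor
  · intro h
    have h := complexEigenvalues_eq_of_isConj h
    rw [complexEigenvalues_rootRotation, complexEigenvalues_rootRotation] at h
    refine Multiset.map_injective (upperRootOfUnity_injective hm)
      (Multiset.eq_of_add_map_conj_eq ?_ ?_ h)
    all_goals
      intro z hz
      obtain ⟨j, -, rfl⟩ := Multiset.mem_map.1 hz
      exact im_upperRootOfUnity_nonneg j
  · intro h
    refine isConj_of_complexEigenvalues_eq hm.ne' (rootRotation_pow hm f) (rootRotation_pow hm g) ?_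
    rw [complexEigenvalues_rootRotation, complexEigenvalues_rootRotation, h]

theorem exists_isConj_rootRotation {m n : ℕ} (hodd : Odd m)
    {x : orthogonalGroup (Fin (2 * n)) ℝ} (hx : x ^ m = 1) :
    ∃ f : Fin n → Fin (m / 2 + 1), IsConj x (rootRotation m f) := by
  have hx' : x.val ^ m = 1 := congrArg Subtype.val hx
  have hcard : x.val.complexEigenvalues.card = 2 * n := by
    rw [card_complexEigenvalues, Fintype.card_fin]
  obtain ⟨M, hM, hxM⟩ := Multiset.exists_add_map_conj_eq (map_conj_complexEigenvalues x.val) hcard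
    fun z hz ↦ Complex.eq_one_of_pow_eq_one_of_im_eq_zero hodd
      (pow_eq_one_of_mem_complexEigenvalues hx' hz)
  obtain ⟨N, rfl⟩ : ∃ N : Multiset (Fin (m / 2 + 1)), N.map (upperRootOfUnity m) = M := by
    choose! g hg using fun z hz ↦
      exists_upperRootOfUnity_eq hodd (pow_eq_one_of_mem_complexEigenvalues hx' (hM z hz).1)
        (hM z hz).2
    exact ⟨M.map g, by
      rw [Multiset.map_map]
      exact (Multiset.map_congr rfl hg).trans (Multiset.map_id' M)⟩
  have hN : N.card = n := by
    rw [hxM] at hcard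
    simp only [Multiset.card_add, Multiset.card_map] at hcard
    lia
  obtain ⟨f, rfl⟩ := Multiset.exists_map_univ_eq hN
  refine ⟨f, isConj_of_complexEigenvalues_eq hodd.pos.ne' hx (rootRotation_pow hodd.pos f) ?_⟩
  rw [hxM, complexEigenvalues_rootRotation]

theorem ncard_upper_spectrum_of_isConj_rootRotation {m n : ℕ} (hodd : Odd m)
    {x : orthogonalGroup (Fin (2 * n)) ℝ} {f : Fin n → Fin (m / 2 + 1)}
    (h : IsConj x (rootRotation m f)) :
    {z : ℂ | z ∈ spectrum ℂ (x.val.map Complex.ofReal) ∧ 0 ≤ z.im}.ncard =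
      (Finset.univ.val.map f).toFinset.card := by
  have hset : {z : ℂ | z ∈ spectrum ℂ (x.val.map Complex.ofReal) ∧ 0 ≤ z.im} =
      upperRootOfUnity m '' (Finset.univ.val.map f).toFinset := by
    ext z
    simp only [Set.mem_ofPred_eq, ← mem_complexEigenvalues, complexEigenvalues_eq_of_isConj h,
      complexEigenvalues_rootRotation, Multiset.mem_add, Set.mem_image, Finset.mem_coe,
      Multiset.mem_toFinset]
    constructor
    · rintro ⟨hz | hz, him⟩
      · exact Multiset.mem_map.1 hz
      · obtain ⟨w, hw, rfl⟩ := Multiset.mem_map.1 hz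
        obtain ⟨j, hj, rfl⟩ := Multiset.mem_map.1 hw
        refine ⟨j, hj, (Complex.conj_eq_iff_im.2 (le_antisymm ?_ ?_)).symm⟩
        · simpa using him
        · exact im_upperRootOfUnity_nonneg j
    · rintro ⟨j, hj, rfl⟩
      exact ⟨.inl (Multiset.mem_map_of_mem _ hj), im_upperRootOfUnity_nonneg j⟩
  rw [hset, Set.ncard_image_of_injective _ (upperRootOfUnity_injective hodd.pos),
    Set.ncard_coe_finset]

/-- For any positive integers `n`, `s` and odd positive integer `m`, the number of
conjugacy classes of the full orthogonal group `O(2n)` consisting of elements `x` with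
`x ^ m = 1` and exactly `s` distinct conjugate pairs of eigenvalues equals
`C(n - 1, s - 1) · C(⌊m/2⌋ + 1, s)`. -/
theorem stmt_14 (n m s : ℕ) (hn : 0 < n) (hm : 0 < m) (hs : 0 < s) (hodd : Odd m) :
    {c : ConjClasses (Matrix.orthogonalGroup (Fin (2 * n)) ℝ) | ∀ x ∈ c.carrier,
        x ^ m = 1 ∧
        {z : ℂ | z ∈ spectrum ℂ ((x : Matrix (Fin (2 * n)) (Fin (2 * n)) ℝ).map
            Complex.ofReal) ∧ 0 ≤ z.im}.ncard = s}.ncard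
      = Nat.choose (n - 1) (s - 1) * Nat.choose (m / 2 + 1) s := by
  rw [← Fintype.card_fin (m / 2 + 1), ← Multiset.ncard_card_eq_and_card_toFinset_eq hn hs]
  choose! F hF using fun (M : Multiset (Fin (m / 2 + 1))) (h : M.card = n) ↦
    Multiset.exists_map_univ_eq h
  symm
  refine Set.ncard_congr (fun M _ ↦ ConjClasses.mk (rootRotation m (F M))) ?_ ?_ ?_
  · rintro M ⟨hM, hMs⟩ x hx
    rw [ConjClasses.mem_carrier_iff_mk_eq, ConjClasses.mk_eq_mk_iff_isConj] at hx
    refine ⟨?_, by rw [ncard_upper_spectrum_of_isConj_rootRotation hodd hx, hF M hM, hMs]⟩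
    obtain ⟨c, rfl⟩ := isConj_iff.1 hx.symm
    rw [conj_pow, rootRotation_pow hm, mul_one, mul_inv_cancel]
  · rintro M N ⟨hM, -⟩ ⟨hN, -⟩ h
    rwa [ConjClasses.mk_eq_mk_iff_isConj, isConj_rootRotation_iff hm, hF M hM, hF N hN] at h
  · intro c hc
    obtain ⟨x, rfl⟩ := ConjClasses.mk_surjective c
    obtain ⟨hxm, hxs⟩ := hc x ConjClasses.mem_carrier_mk
    obtain ⟨f, hf⟩ := exists_isConj_rootRotation hodd hxm
    have hcard : (Finset.univ.val.map f).card = n := by simp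
    refine ⟨Finset.univ.val.map f, ⟨hcard, ?_⟩, ?_⟩
    · rw [← hxs, ncard_upper_spectrum_of_isConj_rootRotation hodd hf]
    · rw [ConjClasses.mk_eq_mk_iff_isConj]
      refine IsConj.trans ?_ hf.symm
      rw [isConj_rootRotation_iff hm, hF _ hcard]
end

section
/- For any positive integer n and any even positive integer m, the number of conjugacy classes of the special orthogonal group SO(2n+1) consisting of elements x with x^m = 1 equals C(n + m/2, m/2). -/
open Matrix

/-- The special orthogonal group, as the subgroup of the orthogonal group
`Matrix.orthogonalGroup (Fin k) ℝ` consisting of the elements of determinant `1`. -/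
noncomputable def SO (k : ℕ) : Subgroup (Matrix.orthogonalGroup (Fin k) ℝ) where
  carrier := {x | (x : Matrix (Fin k) (Fin k) ℝ).det = 1}
  one_mem' := by simp
  mul_mem' := by
    intro a b ha hb
    simp only [Set.mem_setOf_eq, Matrix.UnitaryGroup.mul_val, Matrix.det_mul] at *
    rw [ha, hb, mul_one]
  inv_mem' := by
    intro a ha
    simp only [Set.mem_setOf_eq, Matrix.UnitaryGroup.inv_val, Matrix.star_eq_conjTranspose,
      Matrix.det_conjTranspose, star_trivial] at *
    exact ha

namespace Matrix

/-- Orthogonal similarity of real square matrices, possibly with different index types. -/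
def OrthSimilar {ι κ : Type*} [Fintype ι] [DecidableEq ι] [Fintype κ] [DecidableEq κ]
    (A : Matrix ι ι ℝ) (B : Matrix κ κ ℝ) : Prop :=
  ∃ Q : Matrix ι κ ℝ, Qᵀ * Q = 1 ∧ Q * Qᵀ = 1 ∧ A * Q = Q * B

section OrthSimilar

variable {ι κ l : Type*} [Fintype ι] [DecidableEq ι] [Fintype κ] [DecidableEq κ]
  [Fintype l] [DecidableEq l]

theorem transpose_mul_eq_mul_transpose {A : Matrix ι ι ℝ} {B : Matrix κ κ ℝ} {Q : Matrix ι κ ℝ}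
    (h1 : Qᵀ * Q = 1) (h2 : Q * Qᵀ = 1) (h3 : A * Q = Q * B) : B * Qᵀ = Qᵀ * A :=
  calc B * Qᵀ = Qᵀ * Q * B * Qᵀ := by rw [h1, one_mul]
    _ = Qᵀ * (Q * B) * Qᵀ := by simp only [Matrix.mul_assoc]
    _ = Qᵀ * A * (Q * Qᵀ) := by rw [← h3]; simp only [Matrix.mul_assoc]
    _ = Qᵀ * A := by rw [h2, Matrix.mul_one]

theorem OrthSimilar.symm {A : Matrix ι ι ℝ} {B : Matrix κ κ ℝ} (h : OrthSimilar A B) :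
    OrthSimilar B A := by
  obtain ⟨Q, h1, h2, h3⟩ := h
  exact ⟨Qᵀ, by simpa using h2, by simpa using h1, transpose_mul_eq_mul_transpose h1 h2 h3⟩

theorem OrthSimilar.trans {A : Matrix ι ι ℝ} {B : Matrix κ κ ℝ} {C : Matrix l l ℝ}
    (h : OrthSimilar A B) (h' : OrthSimilar B C) : OrthSimilar A C := by
  obtain ⟨Q, h1, h2, h3⟩ := h
  obtain ⟨R, k1, k2, k3⟩ := h'
  refine ⟨Q * R, ?_, ?_, ?_⟩
  · rw [transpose_mul, Matrix.mul_assoc, ← Matrix.mul_assoc Qᵀ, h1, Matrix.one_mul, k1]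
  · rw [transpose_mul, Matrix.mul_assoc, ← Matrix.mul_assoc R, k2, Matrix.one_mul, h2]
  · rw [← Matrix.mul_assoc, h3, Matrix.mul_assoc, k3, Matrix.mul_assoc]

theorem orthSimilar_submatrix (A : Matrix κ κ ℝ) (e : ι ≃ κ) :
    OrthSimilar (A.submatrix e e) A := by
  refine ⟨(1 : Matrix κ κ ℝ).submatrix e id, ?_, ?_, ?_⟩
  · rw [transpose_submatrix, transpose_one, submatrix_mul_equiv, Matrix.one_mul, submatrix_id_id]
  · rw [transpose_submatrix, transpose_one, ← Equiv.coe_refl, submatrix_mul_equiv, Matrix.one_mul,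
      submatrix_one_equiv]
  · have h : (1 : Matrix κ κ ℝ).submatrix e id * A = (1 * A).submatrix e id := by
      rw [submatrix_mul _ _ e id id Function.bijective_id, submatrix_id_id]
    rw [h, submatrix_mul_equiv, Matrix.one_mul, Matrix.mul_one]

theorem OrthSimilar.fromBlocks {A : Matrix ι ι ℝ} {B : Matrix κ κ ℝ} (C : Matrix l l ℝ)
    (h : OrthSimilar A B) :
    OrthSimilar (Matrix.fromBlocks C 0 0 A) (Matrix.fromBlocks C 0 0 B) := by
  obtain ⟨Q, h1, h2, h3⟩ := h
  refine ⟨Matrix.fromBlocks 1 0 0 Q, ?_, ?_, ?_⟩ <;>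
    simp [fromBlocks_transpose, fromBlocks_multiply, h1, h2, h3]

theorem OrthSimilar.pow_eq_one_iff {A : Matrix ι ι ℝ} {B : Matrix κ κ ℝ} (h : OrthSimilar A B)
    (m : ℕ) : A ^ m = 1 ↔ B ^ m = 1 := by
  obtain ⟨Q, h1, h2, h3⟩ := h
  have key : A ^ m * Q = Q * B ^ m := by
    induction m with
    | zero => simp
    | succ m ih => rw [pow_succ, Matrix.mul_assoc, h3, ← Matrix.mul_assoc, ih, Matrix.mul_assoc,
        ← pow_succ]
  constructor <;> intro h
  · rw [h, Matrix.one_mul] at key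
    rw [← Matrix.one_mul (B ^ m), ← h1, Matrix.mul_assoc, ← key]
  · rw [h, Matrix.mul_one] at key
    rw [← Matrix.mul_one (A ^ m), ← h2, ← Matrix.mul_assoc, key]

theorem OrthSimilar.add_transpose {A : Matrix ι ι ℝ} {B : Matrix κ κ ℝ} (h : OrthSimilar A B) :
    OrthSimilar (A + Aᵀ) (B + Bᵀ) := by
  obtain ⟨Q, h1, h2, h3⟩ := h
  have h4 := congrArg transpose (transpose_mul_eq_mul_transpose h1 h2 h3)
  rw [transpose_mul, transpose_mul, transpose_transpose] at h4
  exact ⟨Q, h1, h2, by rw [Matrix.add_mul, Matrix.mul_add, h3, h4]⟩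

open Polynomial in
theorem OrthSimilar.charpoly_eq {A : Matrix ι ι ℝ} {B : Matrix κ κ ℝ} (h : OrthSimilar A B) :
    A.charpoly = B.charpoly := by
  obtain ⟨Q, h1, h2, h3⟩ := h
  have k1 : Qᵀ.map (C : ℝ →+* ℝ[X]) * Q.map (C : ℝ →+* ℝ[X]) = 1 := by
    rw [← Matrix.map_mul, h1, Matrix.map_one _ (map_zero _) (map_one _)]
  have k2 : Q.map (C : ℝ →+* ℝ[X]) * Qᵀ.map (C : ℝ →+* ℝ[X]) = 1 := by
    rw [← Matrix.map_mul, h2, Matrix.map_one _ (map_zero _) (map_one _)]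
  have k3 : charmatrix A * Q.map (C : ℝ →+* ℝ[X]) = Q.map (C : ℝ →+* ℝ[X]) * charmatrix B := by
    rw [charmatrix, charmatrix, Matrix.sub_mul, Matrix.mul_sub, RingHom.mapMatrix_apply,
      RingHom.mapMatrix_apply, ← Matrix.map_mul, ← Matrix.map_mul, h3, scalar_apply, scalar_apply,
      ← smul_one_eq_diagonal, ← smul_one_eq_diagonal, Matrix.smul_mul, Matrix.mul_smul, Matrix.one_mul,
      Matrix.mul_one]
  have k4 : charmatrix A =
      Q.map (C : ℝ →+* ℝ[X]) * (charmatrix B * Qᵀ.map (C : ℝ →+* ℝ[X])) := by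
    rw [← Matrix.mul_assoc, ← k3, Matrix.mul_assoc, k2, Matrix.mul_one]
  rw [charpoly, charpoly, k4, det_comm' k2 k1, Matrix.mul_assoc, k1, Matrix.mul_one]

end OrthSimilar

/-- The matrix of the rotation of the plane by the angle `θ`. -/
noncomputable def rotation (θ : ℝ) : Matrix (Fin 2) (Fin 2) ℝ :=
  !![Real.cos θ, -Real.sin θ; Real.sin θ, Real.cos θ]

theorem rotation_transpose_mul_self (θ : ℝ) : (rotation θ)ᵀ * rotation θ = 1 := by
  have h := Real.sin_sq_add_cos_sq θ
  ext i j
  fin_cases i <;> fin_cases j <;> simp [rotation, Matrix.mul_apply, Fin.sum_univ_two] <;> grind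

theorem det_rotation (θ : ℝ) : (rotation θ).det = 1 := by
  have h := Real.sin_sq_add_cos_sq θ
  simp [rotation, Matrix.det_fin_two]
  grind

theorem rotation_pow (θ : ℝ) (m : ℕ) : rotation θ ^ m = rotation (m * θ) := by
  induction m with
  | zero =>
    ext i j
    fin_cases i <;> fin_cases j <;> simp [rotation]
  | succ m ih =>
    rw [pow_succ, ih, Nat.cast_add, Nat.cast_one, add_mul, one_mul]
    ext i j
    fin_cases i <;> fin_cases j <;>
      simp [rotation, Matrix.mul_apply, Fin.sum_univ_two, Real.cos_add, Real.sin_add] <;> ring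

theorem rotation_eq_one_iff (θ : ℝ) : rotation θ = 1 ↔ Real.cos θ = 1 := by
  constructor
  · intro h
    simpa [rotation] using congrFun (congrFun h 0) 0
  · intro h
    have h' := Real.sin_sq_add_cos_sq θ
    have hs : Real.sin θ = 0 := by
      rw [h] at h'
      simpa using h'
    ext i j
    fin_cases i <;> fin_cases j <;> simp [rotation, h, hs]

/-- The block diagonal matrix whose diagonal blocks are the rotations by the angles `θ i`,
followed by a single entry `1`. -/
noncomputable def torusMatrix {κ : Type*} [DecidableEq κ] (θ : κ → ℝ) :
    Matrix (Fin 2 × κ ⊕ Unit) (Fin 2 × κ ⊕ Unit) ℝ :=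
  fromBlocks (blockDiagonal fun i => rotation (θ i)) 0 0 1

section torusMatrix

variable {κ κ' : Type*} [Fintype κ] [DecidableEq κ] [Fintype κ'] [DecidableEq κ']

theorem orthSimilar_torusMatrix_comp (θ : κ' → ℝ) (e : κ ≃ κ') :
    OrthSimilar (torusMatrix (θ ∘ e)) (torusMatrix θ) := by
  have : torusMatrix (θ ∘ e) = (torusMatrix θ).submatrix
      (((Equiv.refl (Fin 2)).prodCongr e).sumCongr (Equiv.refl Unit))
      (((Equiv.refl (Fin 2)).prodCongr e).sumCongr (Equiv.refl Unit)) := by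
    ext (⟨i, a⟩ | i) (⟨j, b⟩ | j) <;> simp [torusMatrix, blockDiagonal_apply]
  rw [this]
  exact orthSimilar_submatrix _ _

theorem orthSimilar_fromBlocks_torusMatrix (φ : ℝ) (θ : κ → ℝ) :
    OrthSimilar (fromBlocks (rotation φ) 0 0 (torusMatrix θ))
      (torusMatrix fun i : Option κ => i.elim φ θ) := by
  let e : Fin 2 ⊕ (Fin 2 × κ ⊕ Unit) ≃ Fin 2 × Option κ ⊕ Unit :=
    { toFun := Sum.elim (fun i => Sum.inl (i, none))
        (Sum.elim (fun p => Sum.inl (p.1, some p.2)) Sum.inr)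
      invFun := Sum.elim (fun p => p.2.elim (Sum.inl p.1) fun a => Sum.inr (Sum.inl (p.1, a)))
        (fun u => Sum.inr (Sum.inr u))
      left_inv := by rintro (i | ⟨i, a⟩ | u) <;> rfl
      right_inv := by rintro (⟨i, _ | a⟩ | u) <;> rfl }
  have : fromBlocks (rotation φ) 0 0 (torusMatrix θ) =
      (torusMatrix fun i : Option κ => i.elim φ θ).submatrix e e := by
    ext (i | ⟨i, a⟩ | u) (j | ⟨j, b⟩ | v) <;> simp [e, torusMatrix, blockDiagonal_apply]
  rw [this]
  exact orthSimilar_submatrix _ _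

theorem torusMatrix_transpose_mul_self (θ : κ → ℝ) : (torusMatrix θ)ᵀ * torusMatrix θ = 1 := by
  rw [torusMatrix, fromBlocks_transpose, fromBlocks_multiply, blockDiagonal_transpose,
    ← blockDiagonal_mul]
  simp only [rotation_transpose_mul_self]
  simp only [transpose_zero, Matrix.zero_mul, Matrix.mul_zero, add_zero, zero_add, transpose_one,
    Matrix.one_mul]
  rw [← fromBlocks_one]
  congr 1
  exact blockDiagonal_one

theorem det_torusMatrix (θ : κ → ℝ) : (torusMatrix θ).det = 1 := by
  simp [torusMatrix, det_rotation]

theorem torusMatrix_pow_eq_one_iff (θ : κ → ℝ) (m : ℕ) :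
    torusMatrix θ ^ m = 1 ↔ ∀ i, Real.cos (m * θ i) = 1 := by
  rw [torusMatrix, fromBlocks_diagonal_pow, ← blockDiagonal_pow, one_pow, ← fromBlocks_one,
    fromBlocks_inj, ← blockDiagonal_one, blockDiagonal_inj, funext_iff]
  simp [rotation_pow, rotation_eq_one_iff]

omit [Fintype κ] in
theorem torusMatrix_add_transpose (θ : κ → ℝ) :
    torusMatrix θ + (torusMatrix θ)ᵀ =
      diagonal (Sum.elim (fun p : Fin 2 × κ => 2 * Real.cos (θ p.2)) fun _ : Unit => 2) := by
  ext (⟨i, a⟩ | i) (⟨j, b⟩ | j)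
  · by_cases hab : a = b
    · subst hab
      fin_cases i <;> fin_cases j <;>
        simp [torusMatrix, rotation, blockDiagonal_apply] <;> ring
    · simp [torusMatrix, blockDiagonal_apply, hab, Ne.symm hab]
  · simp [torusMatrix]
  · simp [torusMatrix]
  · simp [torusMatrix]; norm_num

open Polynomial in
theorem roots_charpoly_torusMatrix_add_transpose (θ : κ → ℝ) :
    (torusMatrix θ + (torusMatrix θ)ᵀ).charpoly.roots =
      2 • (Finset.univ.val.map fun i => 2 * Real.cos (θ i)) + {2} := by
  have h : (torusMatrix θ + (torusMatrix θ)ᵀ).charpoly =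
      ((Finset.univ.val.map fun i => 2 * Real.cos (θ i)).map fun a => X - C a).prod ^ 2
        * (X - C 2) := by
    rw [torusMatrix_add_transpose, charpoly_diagonal, Fintype.prod_sum_type,
      Fintype.prod_prod_type]
    simp [sq]
  rw [h, roots_mul, roots_pow, roots_multiset_prod_X_sub_C, roots_X_sub_C]
  exact mul_ne_zero (pow_ne_zero _ (monic_multiset_prod_of_monic _ _
    fun a _ => monic_X_sub_C a).ne_zero) (X_sub_C_ne_zero 2)

end torusMatrix
end Matrix

namespace Matrix
section NormalForm

variable {ι : Type*} [Fintype ι] [DecidableEq ι]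

theorem mulVec_dotProduct_mulVec_of_transpose_mul_self {A : Matrix ι ι ℝ} (hA : Aᵀ * A = 1)
    (v w : ι → ℝ) : (A *ᵥ v) ⬝ᵥ (A *ᵥ w) = v ⬝ᵥ w := by
  rw [dotProduct_mulVec, vecMul_mulVec, ← dotProduct_mulVec, hA, one_mulVec]

omit [DecidableEq ι] in
theorem _root_.OrthonormalBasis.dotProduct_eq_ite {κ : Type*} [Fintype κ] [DecidableEq κ]
    (b : OrthonormalBasis κ ℝ (EuclideanSpace ℝ ι)) (i j : κ) :
    (b i : ι → ℝ) ⬝ᵥ (b j : ι → ℝ) = if i = j then 1 else 0 := by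
  have := orthonormal_iff_ite.mp b.orthonormal i j
  rw [EuclideanSpace.inner_eq_star_dotProduct, star_trivial, dotProduct_comm] at this
  exact this

theorem exists_rotation_pair_of_mul_self_eq_one {A : Matrix ι ι ℝ} (hA : Aᵀ * A = 1)
    (hA2 : A * A = 1) (hι : 3 ≤ Fintype.card ι) :
    ∃ θ ∈ Set.Icc 0 Real.pi, ∃ a b : ι → ℝ, a ⬝ᵥ a = 1 ∧ b ⬝ᵥ b = 1 ∧ a ⬝ᵥ b = 0 ∧
      A *ᵥ a = Real.cos θ • a + Real.sin θ • b ∧ A *ᵥ b = -Real.sin θ • a + Real.cos θ • b := by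
  have hsymm : Aᵀ = A := by
    rw [← Matrix.mul_one Aᵀ, ← hA2, ← Matrix.mul_assoc, hA, Matrix.one_mul]
  have hH : A.IsHermitian := by rwa [IsHermitian, conjTranspose_eq_transpose_of_trivial]
  have hdot := hH.eigenvectorBasis.dotProduct_eq_ite
  have hev := hH.mulVec_eigenvectorBasis
  have hsq : ∀ i, hH.eigenvalues i = 1 ∨ hH.eigenvalues i = -1 := by
    intro i
    have h := mulVec_dotProduct_mulVec_of_transpose_mul_self hA
      (hH.eigenvectorBasis i) (hH.eigenvectorBasis i)
    rw [hev, smul_dotProduct, dotProduct_smul, hdot] at h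
    exact mul_self_eq_one_iff.mp (by simpa using h)
  obtain ⟨i, j, hij, h⟩ := Fintype.exists_ne_map_eq_of_card_lt
    (fun i => decide (hH.eigenvalues i = 1)) (by rw [Fintype.card_bool]; omega)
  have h' : hH.eigenvalues i = hH.eigenvalues j := by
    have h1 : hH.eigenvalues i = 1 ↔ hH.eigenvalues j = 1 := by simpa using h
    rcases hsq i with hi | hi
    · rw [hi, h1.mp hi]
    · rcases hsq j with hj | hj
      · rw [hj, h1.mpr hj]
      · rw [hi, hj]
  have hpi := Real.pi_pos.le
  rcases hsq i with hi | hi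
  · refine ⟨0, ⟨le_rfl, hpi⟩, hH.eigenvectorBasis i, hH.eigenvectorBasis j,
      by simp [hdot], by simp [hdot], by simp [hdot, hij], ?_, ?_⟩
    · rw [hev, hi]; simp
    · rw [hev, ← h', hi]; simp
  · refine ⟨Real.pi, ⟨hpi, le_rfl⟩, hH.eigenvectorBasis i, hH.eigenvectorBasis j,
      by simp [hdot], by simp [hdot], by simp [hdot, hij], ?_, ?_⟩
    · rw [hev, hi]; simp
    · rw [hev, ← h', hi]; simp

theorem exists_rotation_pair_of_mul_self_ne_one {A : Matrix ι ι ℝ} (hA : Aᵀ * A = 1)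
    (hA2 : A * A ≠ 1) :
    ∃ θ ∈ Set.Icc 0 Real.pi, ∃ a b : ι → ℝ, a ⬝ᵥ a = 1 ∧ b ⬝ᵥ b = 1 ∧ a ⬝ᵥ b = 0 ∧
      A *ᵥ a = Real.cos θ • a + Real.sin θ • b ∧ A *ᵥ b = -Real.sin θ • a + Real.cos θ • b := by
  have hH : (A + Aᵀ).IsHermitian := by
    rw [IsHermitian, conjTranspose_eq_transpose_of_trivial, transpose_add, transpose_transpose,
      add_comm]
  obtain ⟨i, hi⟩ : ∃ i, (A * A) *ᵥ hH.eigenvectorBasis i ≠ hH.eigenvectorBasis i := by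
    by_contra! h
    apply hA2
    apply (toEuclideanLin (𝕜 := ℝ)).injective
    refine hH.eigenvectorBasis.toBasis.ext fun i => ?_
    ext k
    simpa [toLpLin_apply] using congrFun (h i) k
  set v : ι → ℝ := (hH.eigenvectorBasis i).ofLp
  set μ := hH.eigenvalues i
  have hvv : v ⬝ᵥ v = 1 := by simpa using hH.eigenvectorBasis.dotProduct_eq_ite i i
  have hμ : A *ᵥ v + Aᵀ *ᵥ v = μ • v := by
    rw [← add_mulVec]
    exact hH.mulVec_eigenvectorBasis i
  have hAA : A *ᵥ (A *ᵥ v) = μ • (A *ᵥ v) - v := by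
    rw [← mulVec_smul, ← hμ, mulVec_add, mulVec_mulVec v A Aᵀ, mul_eq_one_comm.mp hA, one_mulVec,
      add_sub_cancel_right]
  have hiso := mulVec_dotProduct_mulVec_of_transpose_mul_self hA v v
  set w := A *ᵥ v with hw
  set c := v ⬝ᵥ w with hc
  have hwv : w ⬝ᵥ v = c := dotProduct_comm _ _
  have hμc : μ = 2 * c := by
    have h1 := congrArg (fun u => v ⬝ᵥ u) hμ
    simp only [dotProduct_add, dotProduct_smul, hvv, smul_eq_mul, mul_one] at h1
    rw [← hc, dotProduct_mulVec v Aᵀ, vecMul_transpose, ← hw, hwv] at h1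
    linarith
  have hu : (w - c • v) ⬝ᵥ (w - c • v) = 1 - c ^ 2 := by
    simp only [sub_dotProduct, dotProduct_sub, smul_dotProduct, dotProduct_smul, smul_eq_mul,
      hwv, ← hc, hvv, hiso]
    ring
  have hne : w - c • v ≠ 0 := by
    intro h0
    rw [h0, zero_dotProduct] at hu
    have hwc : w = c • v := sub_eq_zero.mp h0
    apply hi
    rw [← mulVec_mulVec, ← hw, hAA, hwc, hμc, smul_smul, show 2 * c * c = 2 by linarith]
    module
  have hpos : 0 < 1 - c ^ 2 := by
    rw [← hu]
    exact lt_of_le_of_ne (Finset.sum_nonneg fun _ _ => mul_self_nonneg _)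
      (Ne.symm fun h => hne (dotProduct_self_eq_zero.mp h))
  set s := √(1 - c ^ 2)
  have hs0 : s ≠ 0 := (Real.sqrt_pos.mpr hpos).ne'
  have hss : s * s = 1 - c ^ 2 := Real.mul_self_sqrt hpos.le
  have hcos : Real.cos (Real.arccos c) = c := Real.cos_arccos (by nlinarith) (by nlinarith)
  have hsin : Real.sin (Real.arccos c) = s := Real.sin_arccos c
  refine ⟨Real.arccos c, ⟨Real.arccos_nonneg c, Real.arccos_le_pi c⟩, v, s⁻¹ • (w - c • v),
    hvv, ?_, ?_, ?_, ?_⟩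
  · rw [smul_dotProduct, dotProduct_smul, hu, ← hss]
    simp only [smul_eq_mul]
    field_simp
  · rw [dotProduct_smul, dotProduct_sub, dotProduct_smul, hvv, ← hc]
    simp
  · rw [hcos, hsin, smul_smul, mul_inv_cancel₀ hs0]
    module
  · rw [hcos, hsin, mulVec_smul, mulVec_sub, mulVec_smul, ← hw, hAA, hμc]
    have h1 : s⁻¹ * (s * s) = s := by field_simp
    have h2 : -s = -(s⁻¹ * (1 - c ^ 2)) := by rw [← hss, h1]
    rw [h2]
    module

theorem exists_orthSimilar_fromBlocks_rotation {A : Matrix ι ι ℝ} (hA : Aᵀ * A = 1) {M : ℕ}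
    (hM : 1 ≤ M) (hι : Fintype.card ι = 2 + M) :
    ∃ θ ∈ Set.Icc 0 Real.pi, ∃ D : Matrix (Fin M) (Fin M) ℝ, Dᵀ * D = 1 ∧ D.det = A.det ∧
      OrthSimilar A (fromBlocks (rotation θ) 0 0 D) := by
  obtain ⟨θ, hθ, a, b, haa, hbb, hab, hAa, hAb⟩ : ∃ θ ∈ Set.Icc 0 Real.pi, ∃ a b : ι → ℝ,
      a ⬝ᵥ a = 1 ∧ b ⬝ᵥ b = 1 ∧ a ⬝ᵥ b = 0 ∧ A *ᵥ a = Real.cos θ • a + Real.sin θ • b ∧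
      A *ᵥ b = -Real.sin θ • a + Real.cos θ • b := by
    by_cases hA2 : A * A = 1
    · exact exists_rotation_pair_of_mul_self_eq_one hA hA2 (by omega)
    · exact exists_rotation_pair_of_mul_self_ne_one hA hA2
  let v : Fin 2 ⊕ Fin M → EuclideanSpace ℝ ι :=
    Sum.elim ![WithLp.toLp 2 a, WithLp.toLp 2 b] 0
  have hv : Orthonormal ℝ ((Set.range (Sum.inl : Fin 2 → Fin 2 ⊕ Fin M)).domRestrict v) := by
    rw [orthonormal_iff_ite]
    rintro ⟨_, i, rfl⟩ ⟨_, j, rfl⟩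
    have hba : b ⬝ᵥ a = 0 := by rw [dotProduct_comm, hab]
    simp only [Set.domRestrict_apply, v, Sum.elim_inl, EuclideanSpace.inner_eq_star_dotProduct,
      star_trivial]
    fin_cases i <;> fin_cases j <;> simp [haa, hbb, hab, hba]
  obtain ⟨B, hB⟩ := hv.exists_orthonormalBasis_extension_of_card_eq (by simp [hι])
  have hB0 : (B (Sum.inl 0) : ι → ℝ) = a := by rw [hB _ ⟨0, rfl⟩]; rfl
  have hB1 : (B (Sum.inl 1) : ι → ℝ) = b := by rw [hB _ ⟨1, rfl⟩]; rfl
  let Q : Matrix ι (Fin 2 ⊕ Fin M) ℝ := of fun i k => B k i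
  have hQ : Qᵀ * Q = 1 := by
    ext k l
    rw [one_apply, ← B.dotProduct_eq_ite]
    rfl
  have hQ' : Q * Qᵀ = 1 := (mul_eq_one_comm_of_card_eq _ _ _ (by simp [hι])).mp hQ
  set N := Qᵀ * A * Q with hN
  have hAN : A * Q = Q * N := by
    rw [hN, Matrix.mul_assoc, ← Matrix.mul_assoc Q, hQ', Matrix.one_mul]
  have hNN : Nᵀ * N = 1 := by
    rw [hN, transpose_mul, transpose_mul, transpose_transpose, Matrix.mul_assoc Qᵀ A Q,
      Matrix.mul_assoc Qᵀ, Matrix.mul_assoc Aᵀ Q, ← Matrix.mul_assoc Q, hQ',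
      Matrix.one_mul, ← Matrix.mul_assoc Aᵀ, hA, Matrix.one_mul, hQ]
  have hNapply : ∀ k l, N k l = (B k : ι → ℝ) ⬝ᵥ (A *ᵥ (B l : ι → ℝ)) := by
    intro k l
    rw [hN, Matrix.mul_assoc]
    rfl
  have h11 : N.toBlocks₁₁ = rotation θ := by
    ext i j
    rw [toBlocks₁₁, of_apply, hNapply]
    have hba : b ⬝ᵥ a = 0 := by rw [dotProduct_comm, hab]
    fin_cases i <;> fin_cases j <;>
      simp [hB0, hB1, hAa, hAb, haa, hbb, hab, hba, rotation]
  have h21 : N.toBlocks₂₁ = 0 := by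
    ext i j
    rw [toBlocks₂₁, of_apply, hNapply]
    have h0 : (B (Sum.inr i) : ι → ℝ) ⬝ᵥ a = 0 := by
      rw [← hB0, B.dotProduct_eq_ite]; simp
    have h1 : (B (Sum.inr i) : ι → ℝ) ⬝ᵥ b = 0 := by
      rw [← hB1, B.dotProduct_eq_ite]; simp
    fin_cases j <;> simp [hB0, hB1, hAa, hAb, h0, h1]
  have hNblocks : N = fromBlocks (rotation θ) N.toBlocks₁₂ 0 N.toBlocks₂₂ := by
    rw [← h11, ← h21, fromBlocks_toBlocks]
  have hmul := hNN
  rw [hNblocks, fromBlocks_transpose, fromBlocks_multiply, ← fromBlocks_one, fromBlocks_inj] at hmul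
  obtain ⟨-, h12, -, h22⟩ := hmul
  have h12' : N.toBlocks₁₂ = 0 := by
    rw [transpose_zero, Matrix.zero_mul, add_zero] at h12
    rw [← Matrix.one_mul N.toBlocks₁₂, ← mul_eq_one_comm.mp (rotation_transpose_mul_self θ),
      Matrix.mul_assoc, h12, Matrix.mul_zero]
  rw [h12'] at hNblocks h22
  refine ⟨θ, hθ, N.toBlocks₂₂, by simpa using h22, ?_, Q, hQ, hQ', ?_⟩
  · have hdet : N.det = A.det := by
      rw [hN, Matrix.mul_assoc, det_comm' hQ hQ', Matrix.mul_assoc, hQ', Matrix.mul_one]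
    rw [← hdet, hNblocks, det_fromBlocks_zero₂₁, det_rotation, one_mul, toBlocks_fromBlocks₂₂]
  · rw [← hNblocks, hAN]

theorem exists_orthSimilar_torusMatrix (n : ℕ) : ∀ {ι : Type} [Fintype ι] [DecidableEq ι]
    {A : Matrix ι ι ℝ}, Fintype.card ι = 2 * n + 1 → Aᵀ * A = 1 → A.det = 1 →
    ∃ θ : Fin n → ℝ, (∀ i, θ i ∈ Set.Icc 0 Real.pi) ∧ OrthSimilar A (torusMatrix θ) := by
  induction n with
  | zero =>
    intro ι _ _ A hι hA hdet
    refine ⟨Fin.elim0, fun i => i.elim0, ?_⟩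
    let e : ι ≃ Fin 2 × Fin 0 ⊕ Unit := Fintype.equivOfCardEq (by simp [hι])
    have : A = (torusMatrix Fin.elim0).submatrix e e := by
      ext i j
      have : Subsingleton ι := Fintype.card_le_one_iff_subsingleton.mp (by omega)
      obtain rfl := Subsingleton.elim i j
      rw [← det_eq_elem_of_card_eq_one (A := A) (by omega) i, hdet, submatrix_apply]
      rcases e i with ⟨_, k⟩ | u
      · exact k.elim0
      · simp [torusMatrix]
    rw [this]
    exact orthSimilar_submatrix _ _
  | succ n ih =>
    intro ι _ _ A hι hA hdet
    obtain ⟨φ, hφ, D, hD, hDdet, hAD⟩ := exists_orthSimilar_fromBlocks_rotation hA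
      (M := 2 * n + 1) (by omega) (by omega)
    obtain ⟨θ, hθ, hDθ⟩ := ih (by simp) hD (hDdet.trans hdet)
    let e : Fin (n + 1) ≃ Option (Fin n) := finSuccEquiv n
    refine ⟨(fun i : Option (Fin n) => i.elim φ θ) ∘ e, fun i => ?_, ?_⟩
    · rcases h : e i with _ | j
      · simpa [h] using hφ
      · simpa [h] using hθ j
    · exact ((hAD.trans (hDθ.fromBlocks _)).trans (orthSimilar_fromBlocks_torusMatrix φ θ)).trans
        (orthSimilar_torusMatrix_comp _ e).symm

end NormalForm
end Matrix

theorem exists_equiv_comp_eq_of_map_univ_eq {κ κ' α : Type*} [Fintype κ] [Fintype κ']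
    {f : κ → α} {g : κ' → α} (h : Finset.univ.val.map f = Finset.univ.val.map g) :
    ∃ e : κ ≃ κ', g ∘ e = f := by
  classical
  have hc (c : α) : Nonempty ({a // f a = c} ≃ {b // g b = c}) := by
    refine Fintype.card_eq.mp ?_
    have := congrArg (Multiset.count c) h
    rw [Multiset.count_map, Multiset.count_map] at this
    rw [Fintype.card_subtype, Fintype.card_subtype]
    simpa [Finset.card, eq_comm] using this
  exact ⟨Equiv.ofFiberEquiv fun c => (hc c).some, funext fun a => Equiv.ofFiberEquiv_map _ a⟩

namespace SO

theorem transpose_mul_self {k : ℕ} (x : SO k) : (x : Matrix (Fin k) (Fin k) ℝ)ᵀ * x = 1 :=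
  (Matrix.mem_orthogonalGroup_iff' _ _).mp x.1.2

theorem mul_transpose_self {k : ℕ} (x : SO k) : (x : Matrix (Fin k) (Fin k) ℝ) * (x.1.1)ᵀ = 1 :=
  (Matrix.mem_orthogonalGroup_iff _ _).mp x.1.2

theorem pow_eq_one_iff {k : ℕ} (x : SO k) (m : ℕ) :
    x ^ m = 1 ↔ (x : Matrix (Fin k) (Fin k) ℝ) ^ m = 1 := by
  rw [Subtype.ext_iff, Subtype.ext_iff]
  simp

theorem exists_coe_eq {k : ℕ} {A : Matrix (Fin k) (Fin k) ℝ} (hA : Aᵀ * A = 1)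
    (hdet : A.det = 1) : ∃ x : SO k, (x : Matrix (Fin k) (Fin k) ℝ) = A :=
  ⟨⟨⟨A, (Matrix.mem_orthogonalGroup_iff' _ _).mpr hA⟩, hdet⟩, rfl⟩

theorem isConj_iff_orthSimilar {n : ℕ} (x y : SO (2 * n + 1)) :
    IsConj x y ↔ OrthSimilar (x : Matrix (Fin (2 * n + 1)) (Fin (2 * n + 1)) ℝ)
      (y : Matrix (Fin (2 * n + 1)) (Fin (2 * n + 1)) ℝ) := by
  rw [isConj_iff]
  constructor
  · rintro ⟨c, hc⟩
    have h : (c : Matrix (Fin (2 * n + 1)) (Fin (2 * n + 1)) ℝ) * x = y * c := by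
      have := congrArg (fun z : SO (2 * n + 1) => (z : Matrix (Fin (2 * n + 1)) (Fin (2 * n + 1)) ℝ))
        (mul_inv_eq_iff_eq_mul.mp hc)
      simpa using this
    exact OrthSimilar.symm ⟨c, transpose_mul_self c, mul_transpose_self c, h.symm⟩
  · intro h
    obtain ⟨Q, h1, h2, h3⟩ := h.symm
    obtain ⟨c, hc⟩ : ∃ c : SO (2 * n + 1),
        (y : Matrix (Fin (2 * n + 1)) (Fin (2 * n + 1)) ℝ) * c = c * x := by
      have hdet : Q.det = 1 ∨ Q.det = -1 := by
        apply mul_self_eq_one_iff.mp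
        simpa using congrArg det h1
      rcases hdet with hd | hd
      · obtain ⟨c, rfl⟩ := exists_coe_eq h1 hd
        exact ⟨c, h3⟩
      · obtain ⟨c, hc⟩ := exists_coe_eq (A := -Q) (by simpa using h1)
          (by rw [det_neg, hd, Fintype.card_fin, pow_succ, pow_mul]; norm_num)
        exact ⟨c, by rw [hc, Matrix.mul_neg, Matrix.neg_mul, h3]⟩
    refine ⟨c, mul_inv_eq_iff_eq_mul.mpr (Subtype.ext (Subtype.ext ?_))⟩
    simpa using hc.symm

theorem exists_orthSimilar_torusMatrix {κ : Type*} [Fintype κ] [DecidableEq κ] {n : ℕ}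
    (hκ : Fintype.card κ = n) (θ : κ → ℝ) :
    ∃ x : SO (2 * n + 1),
      OrthSimilar (x : Matrix (Fin (2 * n + 1)) (Fin (2 * n + 1)) ℝ) (torusMatrix θ) := by
  let e : Fin (2 * n + 1) ≃ Fin 2 × κ ⊕ Unit := Fintype.equivOfCardEq (by simp [hκ])
  obtain ⟨x, hx⟩ := exists_coe_eq (A := (torusMatrix θ).submatrix e e)
    (by rw [transpose_submatrix, submatrix_mul_equiv, torusMatrix_transpose_mul_self,
      submatrix_one_equiv])
    (by rw [det_submatrix_equiv_self, det_torusMatrix])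
  exact ⟨x, hx ▸ orthSimilar_submatrix _ e⟩

end SO

theorem ConjClasses.forall_carrier_pow_eq_one_iff {G : Type*} [Group G] (x : G) (m : ℕ) :
    (∀ y ∈ (ConjClasses.mk x).carrier, y ^ m = 1) ↔ x ^ m = 1 := by
  refine ⟨fun h => h x ConjClasses.mem_carrier_mk, fun h y hy => ?_⟩
  obtain ⟨c, rfl⟩ := isConj_iff.mp (ConjClasses.mk_eq_mk_iff_isConj.mp
    (ConjClasses.mem_carrier_iff_mk_eq.mp hy).symm)
  rw [conj_pow, h, mul_one, mul_inv_cancel]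

/-- The angle `π * j / k`, for `0 ≤ j ≤ k`. -/
noncomputable def rationalAngle (k : ℕ) (j : Fin (k + 1)) : ℝ :=
  Real.pi * j / k

theorem rationalAngle_mem_Icc {k : ℕ} (hk : 0 < k) (j : Fin (k + 1)) :
    rationalAngle k j ∈ Set.Icc 0 Real.pi := by
  have hk' : (0 : ℝ) < k := by exact_mod_cast hk
  have hj : (j : ℝ) ≤ k := by exact_mod_cast Fin.is_le j
  have hpi := Real.pi_pos
  refine ⟨by unfold rationalAngle; positivity, ?_⟩
  rw [rationalAngle, div_le_iff₀ hk']
  gcongr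

theorem injective_two_mul_cos_rationalAngle {k : ℕ} (hk : 0 < k) :
    Function.Injective fun j => 2 * Real.cos (rationalAngle k j) := by
  intro i j hij
  have hk' : (k : ℝ) ≠ 0 := by exact_mod_cast hk.ne'
  have h := Real.injOn_cos (rationalAngle_mem_Icc hk i) (rationalAngle_mem_Icc hk j)
    (mul_left_cancel₀ two_ne_zero hij)
  unfold rationalAngle at h
  have hpi := Real.pi_ne_zero
  field_simp at h
  exact Fin.ext (by exact_mod_cast h)

theorem cos_mul_rationalAngle {k : ℕ} (hk : 0 < k) (j : Fin (k + 1)) :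
    Real.cos ((2 * k : ℕ) * rationalAngle k j) = 1 := by
  have hk' : (k : ℝ) ≠ 0 := by exact_mod_cast hk.ne'
  rw [show ((2 * k : ℕ) : ℝ) * rationalAngle k j = (j : ℕ) * (2 * Real.pi) by
    unfold rationalAngle; push_cast; field_simp]
  exact Real.cos_nat_mul_two_pi j

theorem exists_rationalAngle_eq {k : ℕ} (hk : 0 < k) {θ : ℝ} (hθ : θ ∈ Set.Icc 0 Real.pi)
    (h : Real.cos ((2 * k : ℕ) * θ) = 1) : ∃ j, rationalAngle k j = θ := by
  have hk' : (0 : ℝ) < k := by exact_mod_cast hk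
  have hpi := Real.pi_pos
  obtain ⟨z, hz⟩ := (Real.cos_eq_one_iff _).mp h
  have hz' : z * Real.pi = k * θ := by push_cast at hz; linarith
  have hz0 : 0 ≤ z := by
    have : (0 : ℝ) ≤ z := nonneg_of_mul_nonneg_left (hz' ▸ mul_nonneg hk'.le hθ.1) hpi
    exact_mod_cast this
  have hzk : z ≤ k := by
    have : (z : ℝ) ≤ k :=
      le_of_mul_le_mul_right (hz' ▸ mul_le_mul_of_nonneg_left hθ.2 hk'.le) hpi
    exact_mod_cast this
  lift z to ℕ using hz0
  refine ⟨⟨z, by omega⟩, ?_⟩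
  rw [rationalAngle, div_eq_iff hk'.ne']
  push_cast at hz'
  linarith

instance {α : Type*} [DecidableEq α] (s : Multiset α) : DecidableEq s.ToType :=
  inferInstanceAs (DecidableEq ((a : α) × Fin (s.count a)))

theorem eq_of_orthSimilar_torusMatrix_rationalAngle {k : ℕ} (hk : 0 < k)
    {s t : Multiset (Fin (k + 1))}
    (h : OrthSimilar (torusMatrix fun a : s.ToType => rationalAngle k a)
      (torusMatrix fun a : t.ToType => rationalAngle k a)) : s = t := by
  have hroots := congrArg Polynomial.roots h.add_transpose.charpoly_eq
  rw [roots_charpoly_torusMatrix_add_transpose, roots_charpoly_torusMatrix_add_transpose,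
    add_left_inj] at hroots
  have hmap (u : Multiset (Fin (k + 1))) :
      (Finset.univ.val.map fun a : u.ToType => 2 * Real.cos (rationalAngle k a)) =
        u.map fun j => 2 * Real.cos (rationalAngle k j) := by
    conv_rhs => rw [← Multiset.map_univ_coe u, Multiset.map_map]
    rfl
  rw [hmap, hmap] at hroots
  apply Multiset.map_injective (injective_two_mul_cos_rationalAngle hk)
  ext c
  have := congrArg (Multiset.count c) hroots
  rw [Multiset.count_nsmul, Multiset.count_nsmul] at this
  omega

/-- For any positive integer `n` and even positive integer `m`, the number of conjugacy
classes of `SO(2n+1)` consisting of elements `x` with `x ^ m = 1` equals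
`C(n + m/2, m/2)`. -/
theorem stmt_16 (n m : ℕ) (hn : 0 < n) (hm : 0 < m) (heven : Even m) :
    {c : ConjClasses (SO (2 * n + 1)) | ∀ x ∈ c.carrier, x ^ m = 1}.ncard
      = Nat.choose (n + m / 2) (m / 2) := by
  obtain ⟨k, rfl⟩ := heven.two_dvd
  have hk : 0 < k := by omega
  choose f hf using fun s : Sym (Fin (k + 1)) n =>
    SO.exists_orthSimilar_torusMatrix (κ := (s : Multiset (Fin (k + 1))).ToType)
      (n := n) ((Multiset.card_coe _).trans s.2) fun a => rationalAngle k a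
  have hinj : Function.Injective fun s => ConjClasses.mk (f s) := by
    intro s t hst
    have h := (SO.isConj_iff_orthSimilar _ _).mp (ConjClasses.mk_eq_mk_iff_isConj.mp hst)
    exact Subtype.ext (eq_of_orthSimilar_torusMatrix_rationalAngle hk
      (((hf s).symm.trans h).trans (hf t)))
  have hrange : {c : ConjClasses (SO (2 * n + 1)) | ∀ x ∈ c.carrier, x ^ (2 * k) = 1} =
      Set.range fun s => ConjClasses.mk (f s) := by
    ext c
    obtain ⟨x, rfl⟩ := ConjClasses.mk_surjective c
    rw [Set.mem_ofPred_eq, ConjClasses.forall_carrier_pow_eq_one_iff, SO.pow_eq_one_iff]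
    constructor
    · intro hx
      obtain ⟨θ, hθ, hxθ⟩ := Matrix.exists_orthSimilar_torusMatrix n (by simp)
        (SO.transpose_mul_self x) x.2
      rw [hxθ.pow_eq_one_iff, torusMatrix_pow_eq_one_iff] at hx
      choose j hj using fun i => exists_rationalAngle_eq hk (hθ i) (hx i)
      let s : Sym (Fin (k + 1)) n := ⟨Finset.univ.val.map j, by simp⟩
      obtain ⟨e, he⟩ := exists_equiv_comp_eq_of_map_univ_eq
        (f := j) (g := fun a : (s : Multiset (Fin (k + 1))).ToType => a.1)
        (Multiset.map_univ_coe (s : Multiset (Fin (k + 1)))).symm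
      have hθe : θ = (fun a : (s : Multiset (Fin (k + 1))).ToType => rationalAngle k a) ∘ e := by
        ext i
        rw [← hj, ← he]
        rfl
      refine ⟨s, ConjClasses.mk_eq_mk_iff_isConj.mpr ((SO.isConj_iff_orthSimilar _ _).mpr ?_)⟩
      rw [hθe] at hxθ
      exact (hf s).trans (hxθ.trans (orthSimilar_torusMatrix_comp _ e)).symm
    · rintro ⟨s, hs⟩
      have h := (SO.isConj_iff_orthSimilar _ _).mp (ConjClasses.mk_eq_mk_iff_isConj.mp hs)
      rw [(h.symm.trans (hf s)).pow_eq_one_iff, torusMatrix_pow_eq_one_iff]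
      exact fun i => cos_mul_rationalAngle hk _
  rw [hrange, ← Set.image_univ, Set.ncard_image_of_injective _ hinj, Set.ncard_univ,
    Nat.card_eq_fintype_card, Sym.card_sym_eq_choose, Fintype.card_fin,
    Nat.mul_div_cancel_left k two_pos, show k + 1 + n - 1 = n + k by omega,
    Nat.choose_symm_add]
end
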